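/- Let G be the free associative unital k-algebra on two generators and let ψ : G → A be the k-algebra homomorphism sending the two generators to x₁ and x₂ respectively (so ε_A ∘ ψ equals the augmentation of G sending generators to 0). Then ψ is a paraequivalence: for every n ≥ 1, (a) for every a ∈ A there exists p ∈ G with a − ψ(p) ∈ I(A)ⁿ, and (b) for every p ∈ G, if ψ(p) ∈ I(A)ⁿ then p ∈ I(G)ⁿ. In other words, ψ induces a bijection G/I(G)ⁿ → A/I(A)ⁿ for every n, so A is a finitely generated parafree augmented algebra with parafree generators x₁, x₂. -/

import Mathlib

noncomputable section

/-- The augmentation ideal of an augmented `k`-algebra, as a `k`-submodule. -/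
def augIdeal {k A : Type*} [CommRing k] [Ring A] [Algebra k A] (ε : A →ₐ[k] k) :
    Submodule k A :=
  LinearMap.ker ε.toLinearMap

variable (k : Type*) [CommRing k]

/-- The generators `x₁, x₂, y₁, y₂` of the free algebra `F` on four generators:
`x₁ = Xg k 0`, `x₂ = Xg k 1`, `y₁ = Xg k 2`, `y₂ = Xg k 3`. -/
def Xg (i : Fin 4) : FreeAlgebra k (Fin 4) := FreeAlgebra.ι k i

/-- `r₁ = x₁x₂ + y₁² − y₁`. -/
def r1 : FreeAlgebra k (Fin 4) := Xg k 0 * Xg k 1 + Xg k 2 * Xg k 2 - Xg k 2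
/-- `r₂ = x₂x₁ + y₂² − y₂`. -/
def r2 : FreeAlgebra k (Fin 4) := Xg k 1 * Xg k 0 + Xg k 3 * Xg k 3 - Xg k 3
/-- `r₃ = x₁y₂ − y₁x₁`. -/
def r3 : FreeAlgebra k (Fin 4) := Xg k 0 * Xg k 3 - Xg k 2 * Xg k 0
/-- `r₄ = x₂y₁ − y₂x₂`. -/
def r4 : FreeAlgebra k (Fin 4) := Xg k 1 * Xg k 2 - Xg k 3 * Xg k 1

/-- The relations of `B = F/(r₁, r₂)`. -/
def relB : FreeAlgebra k (Fin 4) → FreeAlgebra k (Fin 4) → Prop := fun a b =>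
  (a = r1 k ∨ a = r2 k) ∧ b = 0

/-- The relations of `A = F/(r₁, r₂, r₃, r₄)`. -/
def relA : FreeAlgebra k (Fin 4) → FreeAlgebra k (Fin 4) → Prop := fun a b =>
  (a = r1 k ∨ a = r2 k ∨ a = r3 k ∨ a = r4 k) ∧ b = 0

/-- `B = F/(r₁, r₂)`. -/
def AlgB : Type _ := RingQuot (relB k)
/-- `A = F/(r₁, r₂, r₃, r₄)`. -/
def AlgA : Type _ := RingQuot (relA k)

instance : Ring (AlgB k) := by unfold AlgB; infer_instance
instance : Algebra k (AlgB k) := by unfold AlgB; infer_instance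
instance : Ring (AlgA k) := by unfold AlgA; infer_instance
instance : Algebra k (AlgA k) := by unfold AlgA; infer_instance

/-- The projection `F → B`. -/
def mkB : FreeAlgebra k (Fin 4) →ₐ[k] AlgB k := RingQuot.mkAlgHom k (relB k)
/-- The projection `F → A`. -/
def mkA : FreeAlgebra k (Fin 4) →ₐ[k] AlgA k := RingQuot.mkAlgHom k (relA k)

/-- The augmentation of `B`, sending every generator to `0`. -/
def εB : AlgB k →ₐ[k] k :=
  RingQuot.liftAlgHom k
    ⟨FreeAlgebra.lift k (fun _ => (0 : k)), by
      rintro a b ⟨h, rfl⟩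
      rcases h with rfl | rfl <;> simp [r1, r2, Xg]⟩

/-- The augmentation of `A`, sending every generator to `0`. -/
def εA : AlgA k →ₐ[k] k :=
  RingQuot.liftAlgHom k
    ⟨FreeAlgebra.lift k (fun _ => (0 : k)), by
      rintro a b ⟨h, rfl⟩
      rcases h with rfl | rfl | rfl | rfl <;> simp [r1, r2, r3, r4, Xg]⟩

/-- The free algebra `G` on two generators. -/
def AlgG : Type _ := FreeAlgebra k (Fin 2)

instance : Ring (AlgG k) := by unfold AlgG; infer_instance
instance : Algebra k (AlgG k) := by unfold AlgG; infer_instance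

/-- The augmentation of `G`, sending the two generators to `0`. -/
def εG : AlgG k →ₐ[k] k := FreeAlgebra.lift k (fun _ => (0 : k))

/-- The algebra map `ψ : G → A` sending the two generators to `x₁` and `x₂`. -/
def ψpara : AlgG k →ₐ[k] AlgA k :=
  FreeAlgebra.lift k ![mkA k (Xg k 0), mkA k (Xg k 1)]

section AugmentationPowers

variable {k} {R : Type*} [Ring R] [Algebra k R] (ε : R →ₐ[k] k)

lemma mem_augIdeal {a : R} : a ∈ augIdeal ε ↔ ε a = 0 := by
  simp [augIdeal]

lemma augIdeal_pow_mul_mem {n : ℕ} (hn : 1 ≤ n) (a : R) {b : R} (hb : b ∈ augIdeal ε ^ n) :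
    a * b ∈ augIdeal ε ^ n := by
  obtain ⟨n, rfl⟩ := Nat.exists_eq_add_of_le' hn
  rw [pow_succ'] at hb ⊢
  refine Submodule.mul_induction_on hb (fun u hu v hv => ?_) (fun u v hu hv => ?_)
  · rw [← mul_assoc]
    refine Submodule.mul_mem_mul ?_ hv
    rw [mem_augIdeal] at hu ⊢
    simp [hu]
  · rw [mul_add]
    exact add_mem hu hv

lemma augIdeal_pow_mul_mem_right {n : ℕ} (hn : 1 ≤ n) {a : R} (b : R)
    (ha : a ∈ augIdeal ε ^ n) : a * b ∈ augIdeal ε ^ n := by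
  obtain ⟨n, rfl⟩ := Nat.exists_eq_add_of_le' hn
  rw [pow_succ] at ha ⊢
  refine Submodule.mul_induction_on ha (fun u hu v hv => ?_) (fun u v hu hv => ?_)
  · rw [mul_assoc]
    refine Submodule.mul_mem_mul hu ?_
    rw [mem_augIdeal] at hv ⊢
    simp [hv]
  · rw [add_mul]
    exact add_mem hu hv

/-- Elements congruent to elements of the range of `φ` modulo `Iⁿ` are closed under products. -/
lemma exists_sub_mem_mul {S : Type*} [Ring S] [Algebra k S] (φ : S →ₐ[k] R) {n : ℕ} (hn : 1 ≤ n)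
    {a b : R} (ha : ∃ p, a - φ p ∈ augIdeal ε ^ n) (hb : ∃ p, b - φ p ∈ augIdeal ε ^ n) :
    ∃ p, a * b - φ p ∈ augIdeal ε ^ n := by
  obtain ⟨p, hp⟩ := ha
  obtain ⟨q, hq⟩ := hb
  refine ⟨p * q, ?_⟩
  have : a * b - φ (p * q) = a * (b - φ q) + (a - φ p) * φ q := by
    rw [map_mul]; noncomm_ring
  rw [this]
  exact add_mem (augIdeal_pow_mul_mem ε hn _ hq) (augIdeal_pow_mul_mem_right ε hn _ hp)

end AugmentationPowers

section WordFiltration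

/-- The monomial of the free algebra on two generators attached to a word. -/
def wordMonomial (w : List (Fin 2)) : FreeAlgebra k (Fin 2) :=
  (w.map (FreeAlgebra.ι k)).prod

lemma wordMonomial_cons (a : Fin 2) (w : List (Fin 2)) :
    wordMonomial k (a :: w) = FreeAlgebra.ι k a * wordMonomial k w := by
  simp [wordMonomial]

lemma wordMonomial_append (v w : List (Fin 2)) :
    wordMonomial k (v ++ w) = wordMonomial k v * wordMonomial k w := by
  simp [wordMonomial]

/-- The words form a basis of the free algebra. -/
def wordBasis : Module.Basis (List (Fin 2)) k (FreeAlgebra k (Fin 2)) :=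
  (FreeAlgebra.basisFreeMonoid k (Fin 2)).reindex FreeMonoid.toList

lemma wordBasis_apply (w : List (Fin 2)) : wordBasis k w = wordMonomial k w := by
  simp [wordBasis, FreeAlgebra.basisFreeMonoid, wordMonomial,
    FreeAlgebra.equivMonoidAlgebraFreeMonoid, FreeMonoid.lift_apply]

/-- The span of the words of length at least `d`. -/
def wordFiltration (d : ℕ) : Submodule k (FreeAlgebra k (Fin 2)) :=
  Submodule.span k (wordMonomial k '' {w | d ≤ w.length})

lemma wordMonomial_mem {d : ℕ} {w : List (Fin 2)} (h : d ≤ w.length) :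
    wordMonomial k w ∈ wordFiltration k d :=
  Submodule.subset_span ⟨w, h, rfl⟩

lemma ι_mem_wordFiltration (a : Fin 2) : FreeAlgebra.ι k a ∈ wordFiltration k 1 := by
  simpa [wordMonomial] using wordMonomial_mem k (w := [a]) (d := 1) (by simp)

lemma wordFiltration_antitone {m n : ℕ} (h : m ≤ n) : wordFiltration k n ≤ wordFiltration k m :=
  Submodule.span_mono (Set.image_mono fun _ hw => h.trans hw)

lemma mem_wordFiltration_zero (p : FreeAlgebra k (Fin 2)) : p ∈ wordFiltration k 0 := by
  have : wordFiltration k 0 = ⊤ := by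
    rw [← (wordBasis k).span_eq, wordFiltration]
    congr 1
    ext x
    simp [wordBasis_apply]
  rw [this]
  trivial

lemma wordFiltration_mul_le (m n : ℕ) :
    wordFiltration k m * wordFiltration k n ≤ wordFiltration k (m + n) := by
  rw [wordFiltration, wordFiltration, Submodule.span_mul_span, Submodule.span_le]
  rintro _ ⟨_, ⟨v, hv, rfl⟩, _, ⟨w, hw, rfl⟩, rfl⟩
  simp only [← wordMonomial_append]
  exact wordMonomial_mem k (by simpa using add_le_add hv hw)

lemma mul_mem_wordFiltration {m n l : ℕ} (h : l ≤ m + n) {a b : FreeAlgebra k (Fin 2)}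
    (ha : a ∈ wordFiltration k m) (hb : b ∈ wordFiltration k n) : a * b ∈ wordFiltration k l :=
  wordFiltration_antitone k h (wordFiltration_mul_le k m n (Submodule.mul_mem_mul ha hb))

lemma wordFiltration_one_pow_le (n : ℕ) : wordFiltration k 1 ^ n ≤ wordFiltration k n := by
  induction n with
  | zero => exact fun p _ => mem_wordFiltration_zero k p
  | succ n ih =>
    rw [pow_succ]
    exact (mul_le_mul_left ih _).trans (wordFiltration_mul_le k n 1)

lemma ι_mul_ι_mem_wordFiltration (a b : Fin 2) :
    FreeAlgebra.ι k a * FreeAlgebra.ι k b ∈ wordFiltration k 2 :=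
  mul_mem_wordFiltration k (m := 1) (n := 1) (by omega) (ι_mem_wordFiltration k a)
    (ι_mem_wordFiltration k b)

/-- The word filtration as a two-sided ideal. -/
def wordIdeal (n : ℕ) : Ideal (FreeAlgebra k (Fin 2)) where
  carrier := wordFiltration k n
  add_mem' := add_mem
  zero_mem' := zero_mem _
  smul_mem' a _ hb := mul_mem_wordFiltration k (by omega) (mem_wordFiltration_zero k a) hb

instance (n : ℕ) : (wordIdeal k n).IsTwoSided :=
  ⟨fun b ha => mul_mem_wordFiltration k (by omega) ha (mem_wordFiltration_zero k b)⟩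

lemma eq_zero_of_forall_mem_wordFiltration {p : FreeAlgebra k (Fin 2)}
    (h : ∀ d, p ∈ wordFiltration k d) : p = 0 := by
  refine (wordBasis k).ext_elem fun w => ?_
  have key : wordFiltration k (w.length + 1) ≤ LinearMap.ker ((wordBasis k).coord w) := by
    rw [wordFiltration, Submodule.span_le]
    rintro _ ⟨v, hv, rfl⟩
    have hvw : v ≠ w := by
      rintro rfl
      simp at hv
    simp [← wordBasis_apply, hvw]
  simpa using key (h _)

/-- The augmentation of the free algebra on two generators. -/
abbrev freeAug : FreeAlgebra k (Fin 2) →ₐ[k] k := FreeAlgebra.lift k fun _ => 0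

lemma sub_algebraMap_mem_wordFiltration (p : FreeAlgebra k (Fin 2)) :
    p - algebraMap k _ (freeAug k p) ∈ wordFiltration k 1 := by
  induction p using FreeAlgebra.induction with
  | grade0 r => simp
  | grade1 a => simpa using ι_mem_wordFiltration k a
  | mul a b ha hb =>
    have : a * b - algebraMap k _ (freeAug k (a * b)) =
        a * (b - algebraMap k _ (freeAug k b)) +
          (a - algebraMap k _ (freeAug k a)) * algebraMap k _ (freeAug k b) := by
      simp only [map_mul]; noncomm_ring
    rw [this]
    exact add_mem (mul_mem_wordFiltration k (by omega) (mem_wordFiltration_zero k _) hb)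
      (mul_mem_wordFiltration k (by omega) ha (mem_wordFiltration_zero k _))
  | add a b ha hb =>
    rw [map_add, map_add, add_sub_add_comm]
    exact add_mem ha hb

lemma mem_wordFiltration_one {p : FreeAlgebra k (Fin 2)} (hp : freeAug k p = 0) :
    p ∈ wordFiltration k 1 := by
  simpa [hp] using sub_algebraMap_mem_wordFiltration k p

lemma wordFiltration_le_augIdeal_pow {n : ℕ} (hn : 1 ≤ n) :
    wordFiltration k n ≤ augIdeal (freeAug k) ^ n := by
  rw [wordFiltration, Submodule.span_le]
  rintro _ ⟨w, hw, rfl⟩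
  have ι_mem (a : Fin 2) : FreeAlgebra.ι k a ∈ augIdeal (freeAug k) := by
    simp [mem_augIdeal]
  induction n, hn using Nat.le_induction generalizing w with
  | base =>
    match w, hw with
    | a :: w, _ =>
      rw [wordMonomial_cons]
      exact augIdeal_pow_mul_mem_right _ le_rfl _ (by simpa using ι_mem a)
  | succ n hn ih =>
    match w, hw with
    | a :: w, hw =>
      rw [wordMonomial_cons, pow_succ']
      exact Submodule.mul_mem_mul (ι_mem a) (ih w (by simpa using hw))

end WordFiltration

section TruncatedRoots

/-- Successive approximations in the free algebra to the root `y = xₐxₐ₊₁ + …`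
of `y = xₐxₐ₊₁ + y²`, with indices modulo `2`. -/
def rootApprox (a : Fin 2) : ℕ → FreeAlgebra k (Fin 2)
  | 0 => 0
  | n + 1 => FreeAlgebra.ι k a * FreeAlgebra.ι k (a + 1) + rootApprox a n * rootApprox a n

lemma fin_two_add_one_add_one (a : Fin 2) : a + 1 + 1 = a := by
  fin_cases a <;> rfl

lemma ι_mul_rootApprox (a : Fin 2) (n : ℕ) :
    FreeAlgebra.ι k a * rootApprox k (a + 1) n = rootApprox k a n * FreeAlgebra.ι k a := by
  induction n with
  | zero => simp [rootApprox]
  | succ n ih =>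
    simp only [rootApprox, mul_add, add_mul, fin_two_add_one_add_one]
    rw [← mul_assoc, ← mul_assoc, ih, mul_assoc (rootApprox k a n), ih, ← mul_assoc]

lemma rootApprox_mem (a : Fin 2) (n : ℕ) : rootApprox k a n ∈ wordFiltration k 2 := by
  induction n with
  | zero => exact zero_mem _
  | succ n ih =>
    exact add_mem (ι_mul_ι_mem_wordFiltration k _ _)
      (mul_mem_wordFiltration k (m := 2) (n := 2) (by omega) ih ih)

lemma rootApprox_succ_sub_mem (a : Fin 2) (n : ℕ) :
    rootApprox k a (n + 1) - rootApprox k a n ∈ wordFiltration k n := by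
  induction n with
  | zero => exact mem_wordFiltration_zero k _
  | succ n ih =>
    have : rootApprox k a (n + 1 + 1) - rootApprox k a (n + 1) =
        rootApprox k a (n + 1) * (rootApprox k a (n + 1) - rootApprox k a n) +
          (rootApprox k a (n + 1) - rootApprox k a n) * rootApprox k a n := by
      have h : rootApprox k a (n + 1 + 1) - rootApprox k a (n + 1) =
          rootApprox k a (n + 1) * rootApprox k a (n + 1) -
            rootApprox k a n * rootApprox k a n :=
        add_sub_add_left_eq_sub _ _ _
      rw [h]
      noncomm_ring
    rw [this]
    exact add_mem (mul_mem_wordFiltration k (by omega) (rootApprox_mem k a _) ih)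
      (mul_mem_wordFiltration k (by omega) ih (rootApprox_mem k a _))

/-- The generator `xₐ₊₁` of `F`. -/
def genX (a : Fin 2) : FreeAlgebra k (Fin 4) := Xg k (![0, 1] a)

/-- The generator `yₐ₊₁` of `F`. -/
def genY (a : Fin 2) : FreeAlgebra k (Fin 4) := Xg k (![2, 3] a)

lemma mkA_of_rel {r : FreeAlgebra k (Fin 4)} (h : r = r1 k ∨ r = r2 k ∨ r = r3 k ∨ r = r4 k) :
    mkA k r = 0 :=
  (RingQuot.mkAlgHom_rel k (s := relA k) ⟨h, rfl⟩).trans (map_zero (mkA k))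

lemma mkA_x_mul_x (a : Fin 2) :
    mkA k (genX k a) * mkA k (genX k (a + 1)) =
      mkA k (genY k a) - mkA k (genY k a) * mkA k (genY k a) := by
  have h : mkA k (genX k a * genX k (a + 1) + genY k a * genY k a - genY k a) = 0 := by
    apply mkA_of_rel
    fin_cases a
    · exact Or.inl rfl
    · exact Or.inr (Or.inl rfl)
  rw [map_sub, map_add, map_mul, map_mul, sub_eq_zero] at h
  exact eq_sub_of_add_eq h

lemma mkA_x_mul_y (a : Fin 2) :
    mkA k (genX k a) * mkA k (genY k (a + 1)) = mkA k (genY k a) * mkA k (genX k a) := by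
  have h : mkA k (genX k a * genY k (a + 1) - genY k a * genX k a) = 0 := by
    apply mkA_of_rel
    fin_cases a
    · exact Or.inr (Or.inr (Or.inl rfl))
    · exact Or.inr (Or.inr (Or.inr rfl))
  rwa [map_sub, map_mul, map_mul, sub_eq_zero] at h

/-- The map `F → G` fixing `x₁, x₂` and replacing `y₁, y₂` by approximate roots. -/
def substRoots (n : ℕ) : FreeAlgebra k (Fin 4) →ₐ[k] FreeAlgebra k (Fin 2) :=
  FreeAlgebra.lift k
    ![FreeAlgebra.ι k 0, FreeAlgebra.ι k 1, rootApprox k 0 n, rootApprox k 1 n]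

lemma substRoots_genX (n : ℕ) (a : Fin 2) : substRoots k n (genX k a) = FreeAlgebra.ι k a := by
  fin_cases a <;> simp [substRoots, genX, Xg]

lemma substRoots_genY (n : ℕ) (a : Fin 2) : substRoots k n (genY k a) = rootApprox k a n := by
  fin_cases a <;> simp [substRoots, genY, Xg]

lemma substRoots_x_mul_x_mem (n : ℕ) (a : Fin 2) :
    substRoots k n (genX k a * genX k (a + 1) + genY k a * genY k a - genY k a) ∈
      wordFiltration k n := by
  simp only [map_sub, map_add, map_mul, substRoots_genX, substRoots_genY]
  exact rootApprox_succ_sub_mem k a n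

lemma substRoots_x_mul_y_mem (n : ℕ) (a : Fin 2) :
    substRoots k n (genX k a * genY k (a + 1) - genY k a * genX k a) ∈ wordFiltration k n := by
  simp only [map_sub, map_mul, substRoots_genX, substRoots_genY, ι_mul_rootApprox, sub_self]
  exact zero_mem _

lemma substRoots_mem_of_rel (n : ℕ) {r s : FreeAlgebra k (Fin 4)} (h : relA k r s) :
    substRoots k n r ∈ wordFiltration k n ∧ s = 0 := by
  refine ⟨?_, h.2⟩
  rcases h.1 with rfl | rfl | rfl | rfl
  · exact substRoots_x_mul_x_mem k n 0
  · exact substRoots_x_mul_x_mem k n 1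
  · exact substRoots_x_mul_y_mem k n 0
  · exact substRoots_x_mul_y_mem k n 1

lemma substRoots_mem_of_mkA_eq_zero (n : ℕ) {f : FreeAlgebra k (Fin 4)} (hf : mkA k f = 0) :
    substRoots k n f ∈ wordFiltration k n := by
  let g := (Ideal.Quotient.mkₐ k (wordIdeal k n)).comp (substRoots k n)
  have w : ∀ ⦃r s⦄, relA k r s → g r = g s := by
    intro r s h
    obtain ⟨hr, rfl⟩ := substRoots_mem_of_rel k n h
    rw [map_zero]
    exact Ideal.Quotient.eq_zero_iff_mem.2 hr
  have h : g f = 0 := by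
    rw [← RingQuot.liftAlgHom_mkAlgHom_apply k g w]
    exact (congrArg _ hf).trans (map_zero (RingQuot.liftAlgHom k ⟨g, w⟩))
  exact Ideal.Quotient.eq_zero_iff_mem.1 h

lemma mkA_surjective : Function.Surjective (mkA k) :=
  RingQuot.mkAlgHom_surjective k (relA k)

lemma εA_mkA (f : FreeAlgebra k (Fin 4)) : εA k (mkA k f) = FreeAlgebra.lift k (fun _ => 0) f :=
  RingQuot.liftAlgHom_mkAlgHom_apply _ _ _ f

lemma freeAug_rootApprox (a : Fin 2) (n : ℕ) : freeAug k (rootApprox k a n) = 0 := by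
  induction n with
  | zero => simp [rootApprox]
  | succ n ih => simp [rootApprox, ih]

lemma freeAug_substRoots (n : ℕ) (f : FreeAlgebra k (Fin 4)) :
    freeAug k (substRoots k n f) = FreeAlgebra.lift k (fun _ => (0 : k)) f := by
  have : (freeAug k).comp (substRoots k n) = FreeAlgebra.lift k (fun _ => (0 : k)) := by
    ext i
    fin_cases i <;> simp [substRoots, freeAug_rootApprox]
  exact DFunLike.congr_fun this f

lemma substRoots_mem_of_mkA_mem {n m : ℕ} (hm : m ≤ n) {f : FreeAlgebra k (Fin 4)}
    (hf : mkA k f ∈ augIdeal (εA k) ^ m) : substRoots k n f ∈ wordFiltration k m := by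
  let J := augIdeal (FreeAlgebra.lift k fun _ : Fin 4 => (0 : k))
  have hJ : augIdeal (εA k) ≤ J.map (mkA k).toLinearMap := by
    intro a ha
    obtain ⟨f, rfl⟩ := mkA_surjective k a
    refine ⟨f, ?_, rfl⟩
    rw [mem_augIdeal, εA_mkA] at ha
    exact (mem_augIdeal _).2 ha
  have hsubst : J.map (substRoots k n).toLinearMap ≤ wordFiltration k 1 := by
    rintro _ ⟨f, hf, rfl⟩
    apply mem_wordFiltration_one
    exact (freeAug_substRoots k n f).trans ((mem_augIdeal _).1 hf)
  obtain ⟨g, hg, hgf⟩ : mkA k f ∈ (J ^ m).map (mkA k).toLinearMap := by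
    rw [Submodule.map_pow]
    exact pow_le_pow_left' hJ m hf
  have hg' : substRoots k n g ∈ wordFiltration k m := by
    have : substRoots k n g ∈ (J ^ m).map (substRoots k n).toLinearMap := ⟨g, hg, rfl⟩
    rw [Submodule.map_pow] at this
    exact wordFiltration_one_pow_le k m (pow_le_pow_left' hsubst m this)
  have hfg : mkA k (f - g) = 0 := by
    rw [map_sub, sub_eq_zero]
    exact hgf.symm
  have := add_mem (wordFiltration_antitone k hm (substRoots_mem_of_mkA_eq_zero k n hfg)) hg'
  rwa [map_sub, sub_add_cancel] at this

end TruncatedRoots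

section NormalForms

/-- The normal form in `F` attached to a word: reading from the left, every occurrence of
`x₁x₂` or `x₂x₁` is contracted to `y₁` or `y₂`. -/
def normalForm : List (Fin 2) → FreeAlgebra k (Fin 4)
  | [] => 1
  | [a] => genX k a
  | a :: b :: w => if b = a then genX k a * normalForm (b :: w) else genY k a * normalForm w

lemma normalForm_cons_self (a : Fin 2) (w : List (Fin 2)) :
    normalForm k (a :: a :: w) = genX k a * normalForm k (a :: w) := by
  simp [normalForm]

lemma normalForm_cons_succ (a : Fin 2) (w : List (Fin 2)) :
    normalForm k (a :: (a + 1) :: w) = genY k a * normalForm k w := by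
  simp [normalForm]

lemma fin_two_eq_or (a b : Fin 2) : b = a ∨ b = a + 1 := by
  fin_cases a <;> fin_cases b <;> simp

section Spanning

variable {k} {R : Type*} [Ring R] [Algebra k R] (π : FreeAlgebra k (Fin 4) →ₐ[k] R)

/-- The span of the images of the normal forms. -/
def normalSpan : Submodule k R :=
  Submodule.span k (Set.range fun w => π (normalForm k w))

lemma normalForm_mem (w : List (Fin 2)) : π (normalForm k w) ∈ normalSpan π :=
  Submodule.subset_span ⟨w, rfl⟩

lemma mul_mem_normalSpan {c : R} (h : ∀ w, c * π (normalForm k w) ∈ normalSpan π) {s : R}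
    (hs : s ∈ normalSpan π) : c * s ∈ normalSpan π := by
  have : normalSpan π ≤ (normalSpan π).comap (LinearMap.mulLeft k c) :=
    Submodule.span_le.2 (by rintro _ ⟨w, rfl⟩; exact h w)
  exact this hs

lemma y_mul_mem_normalSpan (a : Fin 2) {s : R} (hs : s ∈ normalSpan π) :
    π (genY k a) * s ∈ normalSpan π :=
  mul_mem_normalSpan π (fun w => by
    rw [← map_mul, ← normalForm_cons_succ]
    exact normalForm_mem π _) hs

lemma x_mul_normalForm_mem
    (hxx : ∀ a, π (genX k a) * π (genX k (a + 1)) =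
      π (genY k a) - π (genY k a) * π (genY k a))
    (hxy : ∀ a, π (genX k a) * π (genY k (a + 1)) = π (genY k a) * π (genX k a))
    (a : Fin 2) : ∀ w,
    π (genX k a) * π (normalForm k w) ∈ normalSpan π
  | [] => by simpa [normalForm] using normalForm_mem π [a]
  | b :: w => by
    have cancel {u : R} (hu : u ∈ normalSpan π) :
        π (genX k a) * (π (genX k (a + 1)) * u) ∈ normalSpan π := by
      rw [← mul_assoc, hxx, sub_mul, mul_assoc]
      exact sub_mem (y_mul_mem_normalSpan π a hu)
        (y_mul_mem_normalSpan π a (y_mul_mem_normalSpan π a hu))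
    rcases fin_two_eq_or a b with rfl | rfl
    · rw [← map_mul, ← normalForm_cons_self]
      exact normalForm_mem π _
    · match w with
      | [] => simpa [normalForm] using cancel (normalForm_mem π [])
      | c :: w =>
        rcases fin_two_eq_or (a + 1) c with rfl | rfl
        · rw [normalForm_cons_self, map_mul]
          exact cancel (normalForm_mem π _)
        · rw [normalForm_cons_succ, map_mul, ← mul_assoc, hxy, mul_assoc]
          exact y_mul_mem_normalSpan π a (x_mul_normalForm_mem hxx hxy a w)

lemma apply_mul_mem_normalSpan
    (hxx : ∀ a, π (genX k a) * π (genX k (a + 1)) =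
      π (genY k a) - π (genY k a) * π (genY k a))
    (hxy : ∀ a, π (genX k a) * π (genY k (a + 1)) = π (genY k a) * π (genX k a))
    (f : FreeAlgebra k (Fin 4)) :
    ∀ s ∈ normalSpan π, π f * s ∈ normalSpan π := by
  induction f using FreeAlgebra.induction with
  | grade0 r =>
    intro s hs
    rw [AlgHom.commutes, ← Algebra.smul_def]
    exact Submodule.smul_mem _ r hs
  | grade1 i =>
    intro s hs
    fin_cases i
    · exact mul_mem_normalSpan π (x_mul_normalForm_mem π hxx hxy 0) hs
    · exact mul_mem_normalSpan π (x_mul_normalForm_mem π hxx hxy 1) hs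
    · exact y_mul_mem_normalSpan π 0 hs
    · exact y_mul_mem_normalSpan π 1 hs
  | mul f g hf hg =>
    intro s hs
    rw [map_mul, mul_assoc]
    exact hf _ (hg s hs)
  | add f g hf hg =>
    intro s hs
    rw [map_add, add_mul]
    exact add_mem (hf s hs) (hg s hs)

lemma apply_mem_normalSpan
    (hxx : ∀ a, π (genX k a) * π (genX k (a + 1)) =
      π (genY k a) - π (genY k a) * π (genY k a))
    (hxy : ∀ a, π (genX k a) * π (genY k (a + 1)) = π (genY k a) * π (genX k a))
    (f : FreeAlgebra k (Fin 4)) : π f ∈ normalSpan π := by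
  simpa [normalForm] using apply_mul_mem_normalSpan π hxx hxy f _ (normalForm_mem π [])

end Spanning

/-- The linear map `G → F` sending each word to its normal form. -/
def normalLift : FreeAlgebra k (Fin 2) →ₗ[k] FreeAlgebra k (Fin 4) :=
  (wordBasis k).constr k (normalForm k)

lemma normalLift_wordMonomial (w : List (Fin 2)) :
    normalLift k (wordMonomial k w) = normalForm k w := by
  rw [normalLift, ← wordBasis_apply, Module.Basis.constr_basis]

lemma exists_apply_normalLift {R : Type*} [Ring R] [Algebra k R]
    (π : FreeAlgebra k (Fin 4) →ₐ[k] R) {a : R} (ha : a ∈ normalSpan π) :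
    ∃ p, π (normalLift k p) = a := by
  have : normalSpan π ≤ LinearMap.range (π.toLinearMap ∘ₗ normalLift k) := by
    refine Submodule.span_le.2 ?_
    rintro _ ⟨w, rfl⟩
    exact ⟨wordMonomial k w, by simp [normalLift_wordMonomial]⟩
  exact this ha

lemma exists_mkA_normalLift (a : AlgA k) : ∃ p, mkA k (normalLift k p) = a := by
  obtain ⟨f, rfl⟩ := mkA_surjective k a
  exact exists_apply_normalLift k (mkA k)
    (apply_mem_normalSpan (mkA k) (mkA_x_mul_x k) (mkA_x_mul_y k) f)

lemma substRoots_normalForm_sub_mem (n : ℕ) : ∀ w : List (Fin 2),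
    substRoots k (n + 1) (normalForm k w) - wordMonomial k w ∈ wordFiltration k (w.length + 1)
  | [] => by simp [normalForm, wordMonomial]
  | [a] => by simp [normalForm, wordMonomial, substRoots_genX]
  | a :: b :: w => by
    rcases fin_two_eq_or a b with rfl | rfl
    · rw [normalForm_cons_self, map_mul, substRoots_genX, wordMonomial_cons, ← mul_sub]
      exact mul_mem_wordFiltration k (by simp [add_comm]) (ι_mem_wordFiltration k _)
        (substRoots_normalForm_sub_mem n (b :: w))
    · have ih := substRoots_normalForm_sub_mem n w
      have hN : substRoots k (n + 1) (normalForm k w) ∈ wordFiltration k w.length := by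
        simpa using add_mem (wordFiltration_antitone k (Nat.le_succ _) ih)
          (wordMonomial_mem k le_rfl)
      have hsplit : substRoots k (n + 1) (normalForm k (a :: (a + 1) :: w)) -
          wordMonomial k (a :: (a + 1) :: w) =
          rootApprox k a n * rootApprox k a n * substRoots k (n + 1) (normalForm k w) +
          FreeAlgebra.ι k a * FreeAlgebra.ι k (a + 1) *
            (substRoots k (n + 1) (normalForm k w) - wordMonomial k w) := by
        rw [normalForm_cons_succ, map_mul, substRoots_genY, wordMonomial_cons, wordMonomial_cons,
          rootApprox]
        noncomm_ring
      rw [hsplit]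
      refine add_mem (mul_mem_wordFiltration k (m := 4) ?_ ?_ hN)
        (mul_mem_wordFiltration k (m := 2) ?_ ?_ ih)
      · simp; omega
      · exact mul_mem_wordFiltration k (m := 2) (n := 2) (by omega) (rootApprox_mem k a n)
          (rootApprox_mem k a n)
      · simp; omega
      · exact ι_mul_ι_mem_wordFiltration k _ _

lemma substRoots_normalLift_sub_mem (n d : ℕ) {p : FreeAlgebra k (Fin 2)}
    (hp : p ∈ wordFiltration k d) :
    substRoots k (n + 1) (normalLift k p) - p ∈ wordFiltration k (d + 1) := by
  have : wordFiltration k d ≤ (wordFiltration k (d + 1)).comap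
      ((substRoots k (n + 1)).toLinearMap ∘ₗ normalLift k - LinearMap.id) := by
    refine Submodule.span_le.2 ?_
    rintro _ ⟨w, hw, rfl⟩
    have := wordFiltration_antitone k (Nat.succ_le_succ hw) (substRoots_normalForm_sub_mem k n w)
    simpa [normalLift_wordMonomial] using this
  exact this hp

/-- `A` is residually nilpotent. -/
lemma eq_zero_of_forall_mem_augIdeal_pow {a : AlgA k}
    (ha : ∀ n : ℕ, 1 ≤ n → a ∈ augIdeal (εA k) ^ n) : a = 0 := by
  obtain ⟨p, rfl⟩ := exists_mkA_normalLift k a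
  have hp : p = 0 := by
    refine eq_zero_of_forall_mem_wordFiltration k fun d => ?_
    induction d with
    | zero => exact mem_wordFiltration_zero k p
    | succ d ih =>
      have h1 := substRoots_mem_of_mkA_mem k le_rfl (ha (d + 1) (by omega))
      simpa using sub_mem h1 (substRoots_normalLift_sub_mem k d d ih)
  rw [hp, map_zero, map_zero]

end NormalForms

section Paraequivalence

/-- The lift `G → F` of `ψ` along `F → A`. -/
def inclX : FreeAlgebra k (Fin 2) →ₐ[k] FreeAlgebra k (Fin 4) :=
  FreeAlgebra.lift k (genX k)

/-- `ψ`, with its source written as a free algebra. -/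
abbrev freePsi : FreeAlgebra k (Fin 2) →ₐ[k] AlgA k :=
  FreeAlgebra.lift k ![mkA k (Xg k 0), mkA k (Xg k 1)]

lemma mkA_inclX (p : FreeAlgebra k (Fin 2)) : mkA k (inclX k p) = freePsi k p := by
  have : (mkA k).comp (inclX k) = freePsi k := by
    ext a
    fin_cases a <;> simp [inclX, genX]
  exact DFunLike.congr_fun this p

lemma substRoots_inclX (n : ℕ) (p : FreeAlgebra k (Fin 2)) : substRoots k n (inclX k p) = p := by
  have : (substRoots k n).comp (inclX k) = AlgHom.id k _ := by
    ext a
    simp [inclX, substRoots_genX]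
  exact DFunLike.congr_fun this p

lemma εA_genX (a : Fin 2) : εA k (mkA k (genX k a)) = 0 := by
  simp [εA_mkA, genX, Xg]

lemma εA_genY (a : Fin 2) : εA k (mkA k (genY k a)) = 0 := by
  simp [εA_mkA, genY, Xg]

lemma freePsi_ι (a : Fin 2) : freePsi k (FreeAlgebra.ι k a) = mkA k (genX k a) := by
  rw [← mkA_inclX]
  simp [inclX]

lemma εA_freePsi : (εA k).comp (freePsi k) = freeAug k := by
  ext a
  simp only [Function.comp_apply, AlgHom.coe_comp, freePsi_ι, εA_genX]
  simp

lemma mkA_genY_sub_rootApprox_mem (a : Fin 2) (n : ℕ) :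
    mkA k (genY k a) - freePsi k (rootApprox k a n) ∈ augIdeal (εA k) ^ (n + 1) := by
  have hy : mkA k (genY k a) ∈ augIdeal (εA k) := (mem_augIdeal _).2 (εA_genY k a)
  induction n with
  | zero => simpa [rootApprox] using hy
  | succ n ih =>
    have hq : freePsi k (rootApprox k a n) ∈ augIdeal (εA k) := by
      rw [mem_augIdeal, ← freeAug_rootApprox k a n, ← εA_freePsi]
      rfl
    have : mkA k (genY k a) - freePsi k (rootApprox k a (n + 1)) =
        mkA k (genY k a) * (mkA k (genY k a) - freePsi k (rootApprox k a n)) +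
        (mkA k (genY k a) - freePsi k (rootApprox k a n)) * freePsi k (rootApprox k a n) := by
      rw [rootApprox, map_add, map_mul, map_mul, freePsi_ι, freePsi_ι, mkA_x_mul_x]
      noncomm_ring
    rw [this]
    refine add_mem ?_ ?_
    · rw [pow_succ']
      exact Submodule.mul_mem_mul hy ih
    · rw [pow_succ]
      exact Submodule.mul_mem_mul ih hq

lemma exists_sub_freePsi_mem {n : ℕ} (hn : 1 ≤ n) (a : AlgA k) :
    ∃ p, a - freePsi k p ∈ augIdeal (εA k) ^ n := by
  have hx (a : Fin 2) : ∃ p, mkA k (genX k a) - freePsi k p ∈ augIdeal (εA k) ^ n :=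
    ⟨FreeAlgebra.ι k a, by rw [freePsi_ι, sub_self]; exact zero_mem _⟩
  have hy (a : Fin 2) : ∃ p, mkA k (genY k a) - freePsi k p ∈ augIdeal (εA k) ^ n := by
    obtain ⟨n, rfl⟩ := Nat.exists_eq_add_of_le' hn
    exact ⟨_, mkA_genY_sub_rootApprox_mem k a n⟩
  obtain ⟨f, rfl⟩ := mkA_surjective k a
  induction f using FreeAlgebra.induction with
  | grade0 r => exact ⟨algebraMap k _ r, by simp⟩
  | grade1 i =>
    fin_cases i
    · exact hx 0
    · exact hx 1
    · exact hy 0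
    · exact hy 1
  | mul f g hf hg =>
    rw [map_mul]
    exact exists_sub_mem_mul _ _ hn hf hg
  | add f g hf hg =>
    obtain ⟨p, hp⟩ := hf
    obtain ⟨q, hq⟩ := hg
    refine ⟨p + q, ?_⟩
    rw [map_add, map_add, add_sub_add_comm]
    exact add_mem hp hq

lemma mem_augIdeal_pow_of_freePsi_mem {n : ℕ} (hn : 1 ≤ n) {p : FreeAlgebra k (Fin 2)}
    (hp : freePsi k p ∈ augIdeal (εA k) ^ n) : p ∈ augIdeal (freeAug k) ^ n := by
  rw [← mkA_inclX] at hp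
  have := substRoots_mem_of_mkA_mem k le_rfl hp
  rw [substRoots_inclX] at this
  exact wordFiltration_le_augIdeal_pow k hn this

end Paraequivalence

/-- `ψ : G → A` is a paraequivalence: it commutes with the augmentations, and for every
`n ≥ 1` it is surjective and injective modulo the `n`-th powers of the augmentation ideals,
hence induces bijections `G/I(G)ⁿ → A/I(A)ⁿ`.  Moreover `A` is residually nilpotent, so `A`
is a finitely generated parafree augmented algebra with parafree generators `x₁, x₂`. -/
theorem psi_is_paraequivalence :
    (εA k).comp (ψpara k) = εG k
    ∧ (∀ n : ℕ, 1 ≤ n →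
        (∀ a : AlgA k, ∃ p : AlgG k, a - ψpara k p ∈ augIdeal (εA k) ^ n)
        ∧ (∀ p : AlgG k, ψpara k p ∈ augIdeal (εA k) ^ n → p ∈ augIdeal (εG k) ^ n))
    ∧ (⨅ n ∈ {n : ℕ | 1 ≤ n}, augIdeal (εA k) ^ n) = ⊥ := by
  refine ⟨εA_freePsi k, fun n hn => ⟨exists_sub_freePsi_mem k hn, fun p hp =>
    mem_augIdeal_pow_of_freePsi_mem k hn hp⟩, ?_⟩
  rw [eq_bot_iff]
  intro a ha
  simp only [Submodule.mem_iInf, Set.mem_ofPred_eq] at ha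
  exact eq_zero_of_forall_mem_augIdeal_pow k ha
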